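/- arXiv:2004.14342 — 6 statements merged into one kernel-verified Lean document; each statement's English description precedes it below -/
import Mathlib

section
/- Let (N_k)_{k≥0} be a sequence of positive integers and suppose there exist a positive integer k̄ and positive scalars c₁, c₂, c₃ with c₃ < k̄ such that for every k > k̄ one has max{ N_{k−1} + 1, c₂ · k^{1+2c₁} } ≤ N_k ≤ N_{k−1} / (1 − c₃/k). Then both series Σ_{k=1}^∞ (1 − (N_{k−1}/N_k)²) · N_{k−1}^{−1/2} and Σ_{k=1}^∞ ((N_k − N_{k−1})/N_k) · (N_k − N_{k−1})^{−1/2} are finite (convergent). -/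
/-- Sufficient condition on the sequence of cumulative sample sizes for
the convergence of the SMM algorithm (Lemma on sample sizes). -/
theorem stmt_0 (N : ℕ → ℕ) (hNpos : ∀ k, 0 < N k)
    (kbar : ℕ) (hkbar : 0 < kbar) (c₁ c₂ c₃ : ℝ)
    (hc₁ : 0 < c₁) (hc₂ : 0 < c₂) (hc₃ : 0 < c₃) (hc₃k : c₃ < (kbar : ℝ))
    (hbound : ∀ k : ℕ, kbar < k →
      max ((N (k - 1) : ℝ) + 1) (c₂ * (k : ℝ) ^ ((1 : ℝ) + 2 * c₁)) ≤ (N k : ℝ) ∧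
      (N k : ℝ) ≤ (N (k - 1) : ℝ) / (1 - c₃ / (k : ℝ))) :
    Summable (fun k : ℕ =>
      (1 - ((N k : ℝ) / (N (k + 1) : ℝ)) ^ 2) * (1 / Real.sqrt (N k))) ∧
    Summable (fun k : ℕ =>
      ((N (k + 1) : ℝ) - (N k : ℝ)) / (N (k + 1) : ℝ) *
        (1 / Real.sqrt ((N (k + 1) : ℝ) - (N k : ℝ)))) := by
  have hp : Summable (fun k : ℕ => 1 / (k : ℝ) ^ (1 + c₁)) :=
    Real.summable_one_div_nat_rpow.mpr (by linarith)
  have ratio_ge : ∀ k : ℕ, kbar ≤ k →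
      ((N (k + 1) : ℝ) - N k) / N (k + 1) ≤ c₃ / ((k + 1 : ℕ) : ℝ) := by
    intro k hk
    have h := (hbound (k + 1) (by omega)).2
    rw [Nat.add_sub_cancel] at h
    have hM : (0 : ℝ) < N (k + 1) := by exact_mod_cast hNpos _
    have hk' : (kbar : ℝ) < ((k + 1 : ℕ) : ℝ) := by exact_mod_cast Nat.lt_succ_of_le hk
    have hc : c₃ / ((k + 1 : ℕ) : ℝ) < 1 := by
      rw [div_lt_one (by linarith)]
      linarith
    rw [le_div_iff₀ (by linarith)] at h
    rw [div_le_iff₀ hM]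
    linarith
  have increment_ge : ∀ k : ℕ, kbar ≤ k → (1 : ℝ) ≤ (N (k + 1) : ℝ) - N k := by
    intro k hk
    have h := (le_max_left _ _).trans (hbound (k + 1) (by omega)).1
    rw [Nat.add_sub_cancel] at h
    linarith
  have growth : ∀ k : ℕ, kbar < k →
      c₂ * (k : ℝ) ^ (1 + 2 * c₁) ≤ N k :=
    fun k hk => (le_max_right _ _).trans (hbound k hk).1
  constructor
  · refine Summable.of_norm_bounded_eventually_nat (hp.mul_left (2 * c₃ / √c₂)) ?_
    filter_upwards [Filter.eventually_gt_atTop kbar] with k hk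
    have hk1 : (1 : ℝ) ≤ k := by exact_mod_cast (by omega : 1 ≤ k)
    have hk0 : (0 : ℝ) < k := by linarith
    have hM : (0 : ℝ) < N (k + 1) := by exact_mod_cast hNpos _
    have hN : (0 : ℝ) < N k := by exact_mod_cast hNpos _
    have hr := ratio_ge k hk.le
    have hd := increment_ge k hk.le
    rw [sub_div, div_self hM.ne'] at hr
    have hq0 : 0 < (N k : ℝ) / N (k + 1) := by positivity
    have hq1 : (N k : ℝ) / N (k + 1) ≤ 1 := by
      rw [div_le_one hM]
      linarith
    have hck : c₃ / ((k + 1 : ℕ) : ℝ) ≤ c₃ / k := by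
      gcongr
      omega
    generalize (N k : ℝ) / N (k + 1) = q at *
    have hq : 0 ≤ 1 - q ^ 2 := by nlinarith
    have hq' : 1 - q ^ 2 ≤ 2 * (c₃ / k) := by nlinarith [sq_nonneg (1 - q)]
    have hs : √c₂ * (k : ℝ) ^ c₁ ≤ √(N k) := by
      apply Real.le_sqrt_of_sq_le
      rw [mul_pow, Real.sq_sqrt hc₂.le, ← Real.rpow_mul_natCast hk0.le]
      refine le_trans ?_ (growth k hk)
      gcongr
      · push_cast
        linarith
    rw [Real.norm_of_nonneg (by positivity)]
    calc (1 - q ^ 2) * (1 / √(N k))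
        ≤ 2 * (c₃ / k) * (1 / (√c₂ * (k : ℝ) ^ c₁)) := by gcongr
      _ = 2 * c₃ / √c₂ * (1 / (k : ℝ) ^ (1 + c₁)) := by
        rw [Real.rpow_add hk0, Real.rpow_one]
        field_simp
  · refine Summable.of_norm_bounded_eventually_nat
      (((summable_nat_add_iff 1).mpr hp).mul_left (√(c₃ / c₂))) ?_
    filter_upwards [Filter.eventually_gt_atTop kbar] with k hk
    have hM : (0 : ℝ) < N (k + 1) := by exact_mod_cast hNpos _
    have hr := ratio_ge k hk.le
    have hd := increment_ge k hk.le
    have hg := growth (k + 1) (by omega)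
    have hp0 : (0 : ℝ) < ((k + 1 : ℕ) : ℝ) := by positivity
    generalize ((k + 1 : ℕ) : ℝ) = p at *
    generalize (N (k + 1) : ℝ) = M at *
    generalize M - (N k : ℝ) = d at *
    have hd0 : 0 < d := by linarith
    rw [Real.norm_of_nonneg (by positivity)]
    have hsq : d / M * (1 / √d) = √(d / M / M) := by
      rw [div_div, Real.sqrt_div hd0.le, Real.sqrt_mul_self hM.le, mul_one_div, div_right_comm,
        Real.div_sqrt]
    have hpow : p ^ (1 + 2 * c₁) * p = (p ^ (1 + c₁)) ^ 2 := by
      rw [← Real.rpow_mul_natCast hp0.le, ← Real.rpow_add_one hp0.ne']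
      congr 1
      push_cast
      ring
    calc d / M * (1 / √d) = √(d / M / M) := hsq
      _ ≤ √(c₃ / p / (c₂ * p ^ (1 + 2 * c₁))) := by gcongr
      _ = √(c₃ / c₂ / (p ^ (1 + c₁)) ^ 2) := by
        rw [← hpow]
        congr 1
        field_simp
      _ = √(c₃ / c₂) * (1 / p ^ (1 + c₁)) := by
        rw [Real.sqrt_div (by positivity), Real.sqrt_sq (by positivity), mul_one_div]
end

section
/- Let X be a compact convex subset of ℝⁿ, let f : X → ℝ be strongly convex with modulus ζ > 0 on X with unique minimizer x_f on X, and let g : X → ℝ be any function having a minimizer x_g on X, with sup_{x∈X} |f(x) − g(x)| finite. Then for every x̂ ∈ X: ‖x̂ − x_f‖ ≤ ‖x̂ − x_g‖ + (2/√ζ) · √( sup_{x∈X} |f(x) − g(x)| ). -/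
/-- Quadratic growth of a strongly convex function away from a minimizer. -/
theorem StrongConvexOn.add_sq_norm_sub_le_of_isMinOn {E : Type*} [NormedAddCommGroup E]
    [NormedSpace ℝ E] {s : Set E} {m : ℝ} {f : E → ℝ} (hf : StrongConvexOn s m f)
    {x₀ x : E} (hx₀ : x₀ ∈ s) (hmin : IsMinOn f s x₀) (hx : x ∈ s) :
    f x₀ + m / 2 * ‖x - x₀‖ ^ 2 ≤ f x := by
  have growth : ∀ t : ℝ, 0 < t → t < 1 → (1 - t) * (m / 2 * ‖x - x₀‖ ^ 2) ≤ f x - f x₀ := by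
    intro t ht ht1
    have hconv := hf.2 hx hx₀ ht.le (sub_nonneg.2 ht1.le) (add_sub_cancel t 1)
    have hle := hmin (hf.1 hx hx₀ ht.le (sub_nonneg.2 ht1.le) (add_sub_cancel t 1))
    simp only [smul_eq_mul, Set.mem_ofPred_eq] at hconv hle
    refine le_of_mul_le_mul_left ?_ ht
    linarith
  have hlim : Filter.Tendsto (fun t : ℝ => (1 - t) * (m / 2 * ‖x - x₀‖ ^ 2))
      (nhdsWithin 0 (Set.Ioi 0)) (nhds (m / 2 * ‖x - x₀‖ ^ 2)) := by
    have hcont : Continuous fun t : ℝ => (1 - t) * (m / 2 * ‖x - x₀‖ ^ 2) := by fun_prop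
    simpa using (hcont.tendsto 0).mono_left nhdsWithin_le_nhds
  have hle : m / 2 * ‖x - x₀‖ ^ 2 ≤ f x - f x₀ := by
    refine le_of_tendsto hlim ?_
    filter_upwards [Ioo_mem_nhdsGT (zero_lt_one' ℝ)] with t ht using growth t ht.1 ht.2
  linarith

/-- Minimizers of uniformly close functions are close if one function is strongly convex. -/
theorem StrongConvexOn.norm_sub_le_of_isMinOn {E : Type*} [NormedAddCommGroup E]
    [NormedSpace ℝ E] {s : Set E} {m S : ℝ} {f g : E → ℝ} (hf : StrongConvexOn s m f)
    (hm : 0 < m) {x y : E} (hx : x ∈ s) (hfx : IsMinOn f s x) (hy : y ∈ s) (hgy : IsMinOn g s y)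
    (hS : ∀ z ∈ s, |f z - g z| ≤ S) :
    ‖y - x‖ ≤ 2 / √m * √S := by
  have growth := hf.add_sq_norm_sub_le_of_isMinOn hx hfx hy
  have hSx := abs_le.1 (hS x hx)
  have hSy := abs_le.1 (hS y hy)
  have hg : g y ≤ g x := hgy hx
  have hS0 : 0 ≤ S := (abs_nonneg _).trans (hS x hx)
  refine (sq_le_sq₀ (norm_nonneg _) (by positivity)).1 ?_
  rw [mul_pow, div_pow, Real.sq_sqrt hm.le, Real.sq_sqrt hS0, div_mul_eq_mul_div, le_div_iff₀ hm]
  linarith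

/-- Triangle-inequality combination of the perturbation bound for
minimizers of uniformly close functions, where strong convexity with modulus ζ > 0
on a convex set X means that f(x) − (ζ/2)‖x‖² is convex on X. -/
theorem stmt_6 {n : ℕ} (X : Set (EuclideanSpace ℝ (Fin n)))
    (hXcomp : IsCompact X) (hXconv : Convex ℝ X)
    (f g : EuclideanSpace ℝ (Fin n) → ℝ) (ζ : ℝ) (hζ : 0 < ζ)
    (hstrong : ConvexOn ℝ X (fun x => f x - ζ / 2 * ‖x‖ ^ 2))
    (xf : EuclideanSpace ℝ (Fin n)) (hxf : xf ∈ X)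
    (hxfmin : ∀ x ∈ X, f xf ≤ f x)
    (hxfuniq : ∀ x ∈ X, (∀ y ∈ X, f x ≤ f y) → x = xf)
    (xg : EuclideanSpace ℝ (Fin n)) (hxg : xg ∈ X)
    (hxgmin : ∀ x ∈ X, g xg ≤ g x)
    (hbdd : BddAbove ((fun x => |f x - g x|) '' X)) :
    ∀ xhat ∈ X,
      ‖xhat - xf‖ ≤ ‖xhat - xg‖ +
        2 / Real.sqrt ζ * Real.sqrt (sSup ((fun x => |f x - g x|) '' X)) := by
  intro xhat _
  have hclose : ‖xg - xf‖ ≤ 2 / √ζ * √(sSup ((fun x => |f x - g x|) '' X)) :=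
    (strongConvexOn_iff_convex.2 hstrong).norm_sub_le_of_isMinOn hζ hxf hxfmin hxg hxgmin
      fun z hz => le_csSup hbdd (Set.mem_image_of_mem _ hz)
  linarith [norm_sub_le_norm_sub_add_norm_sub xhat xg xf]
end

section
/- Let X be a compact convex subset of ℝⁿ, θ : X → ℝ continuous, x̂ ∈ X, and let V̂ : X → ℝ be convex with V̂(x̂) = θ(x̂), V̂(x) ≥ θ(x) for all x ∈ X, and θ(x) + (κ/2)‖x − x̂‖² ≥ V̂(x) for all x ∈ X for some κ > 0. Let ρ > 0, let M(x̂) be the unique minimizer over X of V̂(x) + (1/(2ρ))‖x − x̂‖², set r := ‖x̂ − M(x̂)‖ and assume r > 0, and define ζ_ρ(x) := θ(x) + (1/(2ρ) + κ/2)‖x − x̂‖². Then there exists x̄ ∈ X such that (i) ζ_ρ(x̄) ≤ ζ_ρ(M(x̂)); (ii) ‖x̄ − x̂‖ ≤ 2r; and (iii) x̄ is a minimizer over X of x ↦ ζ_ρ(x) + (κ r/2)·‖x − x̄‖. -/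
/-- Ekeland's variational principle on a compact set, for a continuous function. -/
theorem IsCompact.exists_ekeland {E : Type*} [PseudoMetricSpace E] {X : Set E}
    (hX : IsCompact X) {f : E → ℝ} (hf : ContinuousOn f X) {a : E} (ha : a ∈ X)
    {c : ℝ} (hc : 0 ≤ c) :
    ∃ b ∈ X, f b + c * dist b a ≤ f a ∧ ∀ x ∈ X, f b ≤ f x + c * dist x b := by
  have hcont : ContinuousOn (fun x => f x + c * dist x a) X := by fun_prop
  obtain ⟨b, hb, hmin⟩ := hX.exists_isMinOn ⟨a, ha⟩ hcont
  refine ⟨b, hb, by simpa using hmin ha, fun x hx => ?_⟩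
  have hbx : f b + c * dist b a ≤ f x + c * dist x a := hmin hx
  have htri := mul_le_mul_of_nonneg_left (dist_triangle x b a) hc
  linarith


/-- Ekeland-point produced from the proximal MM point: a point x̄ with
no larger ζ_ρ value, within 2r of x̂, minimizing the penalized function
ζ_ρ(·) + (κr/2)‖· − x̄‖ over X. -/
theorem stmt_9 {n : ℕ} (X : Set (EuclideanSpace ℝ (Fin n)))
    (hXcomp : IsCompact X) (hXconv : Convex ℝ X)
    (θ : EuclideanSpace ℝ (Fin n) → ℝ) (hθcont : ContinuousOn θ X)
    (xhat : EuclideanSpace ℝ (Fin n)) (hxhat : xhat ∈ X)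
    (Vhat : EuclideanSpace ℝ (Fin n) → ℝ) (hVconv : ConvexOn ℝ X Vhat)
    (htouch : Vhat xhat = θ xhat)
    (hmaj : ∀ x ∈ X, θ x ≤ Vhat x)
    (κ : ℝ) (hκ : 0 < κ)
    (hgap : ∀ x ∈ X, Vhat x ≤ θ x + κ / 2 * ‖x - xhat‖ ^ 2)
    (ρ : ℝ) (hρ : 0 < ρ)
    (M : EuclideanSpace ℝ (Fin n)) (hM : M ∈ X)
    (hMmin : ∀ x ∈ X,
      Vhat M + 1 / (2 * ρ) * ‖M - xhat‖ ^ 2 ≤ Vhat x + 1 / (2 * ρ) * ‖x - xhat‖ ^ 2)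
    (hMuniq : ∀ x ∈ X,
      (∀ y ∈ X, Vhat x + 1 / (2 * ρ) * ‖x - xhat‖ ^ 2 ≤
        Vhat y + 1 / (2 * ρ) * ‖y - xhat‖ ^ 2) → x = M)
    (r : ℝ) (hr : r = ‖xhat - M‖) (hrpos : 0 < r) :
    ∃ xbar ∈ X,
      (θ xbar + (1 / (2 * ρ) + κ / 2) * ‖xbar - xhat‖ ^ 2 ≤
        θ M + (1 / (2 * ρ) + κ / 2) * ‖M - xhat‖ ^ 2) ∧
      ‖xbar - xhat‖ ≤ 2 * r ∧
      ∀ x ∈ X,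
        θ xbar + (1 / (2 * ρ) + κ / 2) * ‖xbar - xhat‖ ^ 2 ≤
          θ x + (1 / (2 * ρ) + κ / 2) * ‖x - xhat‖ ^ 2 + κ * r / 2 * ‖x - xbar‖ := by
  have hζ : ContinuousOn (fun x => θ x + (1 / (2 * ρ) + κ / 2) * ‖x - xhat‖ ^ 2) X := by
    fun_prop
  have hc : 0 < κ * r / 2 := by positivity
  obtain ⟨b, hb, hbM, hbmin⟩ := hXcomp.exists_ekeland hζ hM hc.le
  simp only [dist_eq_norm] at hbM hbmin
  have hMr : ‖M - xhat‖ = r := by rw [hr, norm_sub_rev]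
  have hbr : ‖b - M‖ ≤ r := by
    refine le_of_mul_le_mul_left ?_ hc
    have hεmin := hMmin b hb
    rw [hMr] at hbM hεmin
    linarith [hgap b hb, hmaj M hM]
  refine ⟨b, hb, ?_, ?_, hbmin⟩
  · linarith [mul_nonneg hc.le (norm_nonneg (b - M))]
  · linarith [norm_sub_le_norm_sub_add_norm_sub b M xhat]
end

section
/- Let X be a nonempty compact convex subset of ℝⁿ and let V̂ : X × X → ℝ be such that for each x′ ∈ X the function V̂(·;x′) is convex and continuous on X. For x, x′ ∈ X define the subdifferential set ∂_x V̂(x;x′) := { a ∈ ℝⁿ : V̂(y;x′) ≥ V̂(x;x′) + ⟨a, y − x⟩ for all y ∈ X }, and assume its graph { (a, x, x′) : a ∈ ∂_x V̂(x;x′) } is a closed subset of ℝⁿ × X × X. Fix ρ > 0 and let M(x′) denote the unique minimizer over X of x ↦ V̂(x;x′) + (1/(2ρ))‖x − x′‖². Then the map M : X → X is continuous, and M has a fixed point in X. -/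
open scoped RealInnerProductSpace

open Filter Topology MeasureTheory Set Metric

/-- The nearest-point map onto a nonempty compact convex set. -/
theorem exists_lipschitz_proj {E : Type*} [NormedAddCommGroup E] [InnerProductSpace ℝ E]
    {X : Set E} (hne : X.Nonempty) (hcomp : IsCompact X) (hconv : Convex ℝ X) :
    ∃ P : E → E, LipschitzWith 1 P ∧ (∀ x, P x ∈ X) ∧ (∀ x ∈ X, P x = x) ∧
      ∀ x, P x ∈ interior X → P x = x := by
  choose P hPX hP using exists_norm_eq_iInf_of_complete_convex hne hcomp.isComplete hconv
  have hinner : ∀ x, ∀ w ∈ X, ⟪x - P x, w - P x⟫ ≤ 0 := fun x =>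
    (norm_eq_iInf_iff_real_inner_le_zero hconv (hPX x)).1 (hP x)
  refine ⟨P, ?_, hPX, fun x hx => ?_, fun x hx => ?_⟩
  · refine LipschitzWith.of_dist_le_mul fun x y => ?_
    simp only [NNReal.coe_one, one_mul, dist_eq_norm]
    have h1 := hinner x _ (hPX y)
    have h2 := hinner y _ (hPX x)
    have h3 : ‖P x - P y‖ ^ 2 ≤ ⟪x - y, P x - P y⟫ := by
      rw [← real_inner_self_eq_norm_sq]
      simp only [inner_sub_left, inner_sub_right] at *
      linarith
    have h4 := real_inner_le_norm (x - y) (P x - P y)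
    by_contra! hlt
    nlinarith [norm_nonneg (x - y), norm_nonneg (P x - P y)]
  · have h := hinner x x hx
    rw [real_inner_self_nonpos, sub_eq_zero] at h
    exact h.symm
  · have hlim : Tendsto (fun t : ℝ => P x + t • (x - P x)) (𝓝[>] 0) (𝓝 (P x)) := by
      have : Continuous fun t : ℝ => P x + t • (x - P x) := by fun_prop
      simpa using (this.tendsto 0).mono_left nhdsWithin_le_nhds
    obtain ⟨t, htX, ht⟩ := ((hlim.eventually (isOpen_interior.mem_nhds hx)).and
      self_mem_nhdsWithin).exists
    have h := hinner x _ (interior_subset htX)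
    rw [add_sub_cancel_left, inner_smul_right] at h
    have h' := nonpos_of_mul_nonpos_right h ht
    rw [real_inner_self_nonpos, sub_eq_zero] at h'
    exact h'.symm

/-- As `det (1 + t A)` is a polynomial in `t`, its value at `t = 1` is a fixed linear combination
of its values at finitely many small `t`. -/
theorem exists_det_one_add_eq_sum (E : Type*) [NormedAddCommGroup E] [NormedSpace ℝ E]
    [FiniteDimensional ℝ E] {δ : ℝ} (hδ : 0 < δ) :
    ∃ (s : Finset ℕ) (t c : ℕ → ℝ), (∀ i ∈ s, 0 < t i ∧ t i < δ) ∧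
      ∀ A : E →L[ℝ] E, (1 + A).det = ∑ i ∈ s, c i * (1 + t i • A).det := by
  classical
  let N := Module.finrank ℝ E
  let s := Finset.range (N + 1)
  let t : ℕ → ℝ := fun i => δ / (i + 2)
  have hinj : Set.InjOn t s := by
    intro i _ j _ hij
    simp only [t] at hij
    field_simp at hij
    have : (i : ℝ) = j := by linarith
    exact_mod_cast this
  refine ⟨s, t, fun i => (Lagrange.basis s t i).eval 1, fun i _ => ⟨by positivity, ?_⟩,
    fun A => ?_⟩
  · have : (0 : ℝ) ≤ i := i.cast_nonneg
    exact div_lt_self hδ (by linarith)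
  · let b := Module.finBasis ℝ E
    let T := LinearMap.toMatrix b b (A : E →ₗ[ℝ] E)
    let p : Polynomial ℝ := ((Polynomial.X : Polynomial ℝ) • T.map Polynomial.C +
      (1 : Matrix (Fin N) (Fin N) ℝ).map Polynomial.C).det
    have hp : ∀ r : ℝ, p.eval r = (1 + r • A).det := by
      intro r
      have h1 : (1 + r • A).det = LinearMap.det ((1 + r • A : E →L[ℝ] E) : E →ₗ[ℝ] E) := rfl
      have h2 : LinearMap.toMatrix b b ((1 + r • A : E →L[ℝ] E) : E →ₗ[ℝ] E) = 1 + r • T := by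
        have : ((1 + r • A : E →L[ℝ] E) : E →ₗ[ℝ] E) = 1 + r • (A : E →ₗ[ℝ] E) := rfl
        rw [this, map_add, map_smul, LinearMap.toMatrix_one]
      rw [h1, ← LinearMap.det_toMatrix b, h2, ← Polynomial.coe_evalRingHom, RingHom.map_det]
      congr 1
      ext i j
      by_cases hij : i = j <;> simp [hij] <;> ring
    have hdeg : p.degree < s.card := by
      refine (Polynomial.degree_le_natDegree).trans_lt ?_
      have := Polynomial.natDegree_det_X_add_C_le T 1
      simp only [Fintype.card_fin] at this
      simp only [s, Finset.card_range]
      exact_mod_cast Nat.lt_succ_of_le this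
    have := congrArg (Polynomial.eval 1) (Lagrange.eq_interpolate hinj hdeg)
    rw [Lagrange.interpolate_apply, Polynomial.eval_finsetSum, hp, one_smul] at this
    rw [this]
    refine Finset.sum_congr rfl fun i _ => ?_
    simp [hp, mul_comm]

/-- A small Lipschitz perturbation of the identity that fixes the complement of `U` is a bijection
of `U`. -/
theorem bijOn_id_add {E : Type*} [NormedAddCommGroup E] [CompleteSpace E]
    {k : E → E} {K : NNReal} (hk : LipschitzWith K k) (hK : K < 1) {U : Set E}
    (hzero : ∀ x ∉ U, k x = 0) : Set.BijOn (fun x => x + k x) U U := by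
  have hinj : Function.Injective fun x => x + k x := by
    intro x y hxy
    have h1 := hk.dist_le_mul x y
    have h2 : k x - k y = y - x := by
      have : x + k x = y + k y := hxy
      rw [sub_eq_sub_iff_add_eq_add, add_comm, this, add_comm]
    rw [dist_eq_norm, h2, ← dist_eq_norm, dist_comm y x] at h1
    have h3 : (K : ℝ) < 1 := hK
    by_contra hne
    nlinarith [dist_pos.2 hne]
  have hsurj : Function.Surjective fun x => x + k x := by
    intro y
    have hc : ContractingWith K fun x => y - k x :=
      ⟨hK, LipschitzWith.of_dist_le_mul fun a b => by
        rw [dist_sub_left]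
        exact hk.dist_le_mul a b⟩
    refine ⟨hc.fixedPoint _, ?_⟩
    have := hc.fixedPoint_isFixedPt
    exact add_eq_of_eq_sub this.eq.symm
  refine ⟨fun x hx => ?_, hinj.injOn, fun y hy => ?_⟩
  · by_contra hU
    have h : x + k x = x := hinj (by simpa using hzero _ hU)
    have hU' : x + k x ∉ U := hU
    rw [h] at hU'
    exact hU' hx
  · obtain ⟨x, rfl⟩ := hsurj y
    refine ⟨x, ?_, rfl⟩
    by_contra hU
    simp only [hzero x hU, add_zero] at hy
    exact hU hy

/-- A Lipschitz perturbation of the identity that is supported in `U` and differentiable there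
preserves the signed volume of `U`. -/
theorem integral_det_one_add_fderiv {E : Type*} [NormedAddCommGroup E] [NormedSpace ℝ E]
    [FiniteDimensional ℝ E] [MeasurableSpace E] [BorelSpace E] (μ : Measure E)
    [μ.IsAddHaarMeasure] {h : E → E} {K : NNReal} (hh : LipschitzWith K h) {U : Set E}
    (hU : IsOpen U) (hfin : μ U ≠ ⊤) (hzero : ∀ x ∉ U, h x = 0)
    (hdiff : ∀ x ∈ U, DifferentiableAt ℝ h x) :
    ∫ x in U, (1 + fderiv ℝ h x).det ∂μ = μ.real U := by
  have := FiniteDimensional.complete ℝ E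
  have hdet : ∀ᶠ A : E →L[ℝ] E in 𝓝 1, 0 < A.det := by
    refine (ContinuousLinearMap.continuous_det.tendsto 1).eventually (lt_mem_nhds ?_)
    have : (1 : E →L[ℝ] E).det = LinearMap.det (1 : E →ₗ[ℝ] E) := rfl
    rw [this, map_one]
    exact one_pos
  obtain ⟨ε, hε, hball⟩ := Metric.eventually_nhds_iff.1 hdet
  let δ : ℝ := min ε 1 / (K + 1)
  have hδ : 0 < δ := by positivity
  have key : ∀ t : ℝ, 0 < t → t < δ → IntegrableOn (fun x => (1 + t • fderiv ℝ h x).det) U μ ∧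
      ∫ x in U, (1 + t • fderiv ℝ h x).det ∂μ = μ.real U := by
    intro t ht htδ
    have htK : t * (K + 1) < min ε 1 := (lt_div_iff₀ (by positivity)).1 htδ
    have hLip : LipschitzWith (t.toNNReal * K) fun x => t • h x :=
      LipschitzWith.of_dist_le_mul fun x y => by
        have := hh.dist_le_mul x y
        rw [dist_smul₀, NNReal.coe_mul, Real.coe_toNNReal _ ht.le, Real.norm_of_nonneg ht.le,
          mul_assoc]
        gcongr
    have htK1 : t.toNNReal * K < 1 := by
      rw [← NNReal.coe_lt_coe, NNReal.coe_mul, Real.coe_toNNReal _ ht.le]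
      have := htK.trans_le (min_le_right _ _)
      push_cast
      linarith
    have hbij := bijOn_id_add hLip htK1 (U := U) fun x hx => by simp [hzero x hx]
    have hder : ∀ x ∈ U, HasFDerivWithinAt (fun x => x + t • h x) (1 + t • fderiv ℝ h x) U x :=
      fun x hx => ((hasFDerivAt_id x).add
        ((hdiff x hx).hasFDerivAt.const_smul t)).hasFDerivWithinAt
    have hpos : ∀ x, 0 < (1 + t • fderiv ℝ h x).det := by
      intro x
      apply hball
      rw [dist_eq_norm, add_sub_cancel_left, norm_smul, Real.norm_of_nonneg ht.le]
      have h1 := norm_fderiv_le_of_lipschitz ℝ hh (x₀ := x)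
      have h2 := htK.trans_le (min_le_left _ _)
      nlinarith
    have h1 := integrableOn_image_iff_integrableOn_abs_det_fderiv_smul μ hU.measurableSet hder
      hbij.injOn (fun _ => (1 : ℝ))
    have h2 := integral_image_eq_integral_abs_det_fderiv_smul μ hU.measurableSet hder
      hbij.injOn (fun _ => (1 : ℝ))
    rw [hbij.image_eq] at h1 h2
    simp only [abs_of_pos (hpos _), smul_eq_mul, mul_one, setIntegral_const] at h1 h2
    exact ⟨h1.1 (integrableOn_const hfin), h2.symm⟩
  obtain ⟨s, t, c, ht, hsum⟩ := exists_det_one_add_eq_sum E hδ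
  have hc : ∑ i ∈ s, c i = 1 := by
    have h0 := hsum 0
    have h1 : (1 : E →L[ℝ] E).det = 1 := by
      have : (1 : E →L[ℝ] E).det = LinearMap.det (1 : E →ₗ[ℝ] E) := rfl
      rw [this, map_one]
    simp only [smul_zero, add_zero, h1, mul_one] at h0
    exact h0.symm
  simp_rw [fun x => hsum (fderiv ℝ h x)]
  rw [integral_finsetSum _ fun i hi => ((key _ (ht i hi).1 (ht i hi).2).1.const_mul _)]
  rw [Finset.sum_congr rfl fun i hi => by
    rw [integral_const_mul, (key _ (ht i hi).1 (ht i hi).2).2]]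
  rw [← Finset.sum_mul, hc, one_mul]

section Brouwer

variable {E : Type*} [NormedAddCommGroup E] [InnerProductSpace ℝ E] [FiniteDimensional ℝ E]

/-- There is no `C¹` retraction of the closed unit ball onto the unit sphere. -/
theorem not_contDiffOn_retraction {r : E → E} (hr : ContDiffOn ℝ 1 r (closedBall 0 1))
    (hsphere : ∀ x, ‖x‖ = 1 → r x = x) (hnorm : ∀ x, ‖x‖ < 1 → ‖r x‖ = 1) : False := by
  borelize E
  obtain ⟨P, hPlip, hPmem, hPid, hPint⟩ := exists_lipschitz_proj
    (nonempty_closedBall.2 zero_le_one) (isCompact_closedBall (0 : E) 1) (convex_closedBall 0 1)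
  obtain ⟨K, hK⟩ := hr.exists_lipschitzOnWith one_ne_zero (convex_closedBall 0 1)
    (isCompact_closedBall 0 1)
  have hrP : LipschitzWith (K * 1) fun x => r (P x) :=
    lipschitzOnWith_univ.1 (hK.comp hPlip.lipschitzOnWith fun x _ => hPmem x)
  have hloc : ∀ x ∈ ball (0 : E) 1, (fun x => r (P x) - P x) =ᶠ[𝓝 x] fun x => r x - x := by
    intro x hx
    filter_upwards [isOpen_ball.mem_nhds hx] with y hy
    rw [hPid y (ball_subset_closedBall hy)]
  have hrdiff : ∀ x ∈ ball (0 : E) 1, DifferentiableAt ℝ r x := fun x hx =>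
    (hr.contDiffAt (mem_of_superset (isOpen_ball.mem_nhds hx)
      ball_subset_closedBall)).differentiableAt one_ne_zero
  have hint := integral_det_one_add_fderiv volume (hrP.sub hPlip) (isOpen_ball (x := 0) (ε := 1))
    measure_ball_lt_top.ne (fun x hx => ?_) fun x hx =>
      ((hrdiff x hx).sub differentiableAt_id).congr_of_eventuallyEq (hloc x hx)
  · have hzero : ∀ x ∈ ball (0 : E) 1,
        (1 + fderiv ℝ (fun x => r (P x) - P x) x).det = 0 := by
      intro x hx
      have hfd : 1 + fderiv ℝ (fun x => r (P x) - P x) x = fderiv ℝ r x := by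
        rw [(hloc x hx).fderiv_eq, fderiv_fun_sub (hrdiff x hx) differentiableAt_fun_id, fderiv_fun_id]
        exact add_sub_cancel _ _
      rw [hfd]
      by_contra hdet
      have hunit : IsUnit (LinearMap.det (fderiv ℝ r x : E →ₗ[ℝ] E)) := isUnit_iff_ne_zero.2 hdet
      obtain ⟨v, hv⟩ := ((Module.End.isUnit_iff _).1
        ((LinearMap.isUnit_iff_isUnit_det _).2 hunit)).surjective (r x)
      have hv' : fderiv ℝ r x v = r x := hv
      have hconst : (fun y => ‖r y‖ ^ 2) =ᶠ[𝓝 x] fun _ => 1 := by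
        filter_upwards [isOpen_ball.mem_nhds hx] with y hy
        rw [hnorm y (mem_ball_zero_iff.1 hy), one_pow]
      have h1 := (hrdiff x hx).hasFDerivAt.norm_sq
      have h2 := h1.unique ((hasFDerivAt_const (1 : ℝ) x).congr_of_eventuallyEq hconst)
      have h3 := congrArg (fun L => L v) h2
      simp [hv', hnorm x (mem_ball_zero_iff.1 hx)] at h3
    rw [setIntegral_congr_fun measurableSet_ball hzero, integral_zero] at hint
    exact (ENNReal.toReal_pos (measure_ball_pos volume (0 : E) one_pos).ne'
      measure_ball_lt_top.ne).ne hint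
  · by_cases h1 : ‖P x‖ < 1
    · have h2 := hPint x (by
        rw [mem_interior_iff_mem_nhds]
        exact mem_of_superset (isOpen_ball.mem_nhds (mem_ball_zero_iff.2 h1))
          ball_subset_closedBall)
      rw [h2] at h1
      exact absurd (mem_ball_zero_iff.2 h1) hx
    · have h2 := mem_closedBall_zero_iff.1 (hPmem x)
      rw [hsphere _ (le_antisymm h2 (not_lt.1 h1)), sub_self]

/-- Brouwer's fixed point theorem for `C¹` self-maps of the closed unit ball. -/
theorem ContDiff.exists_fixedPoint_closedBall {g : E → E} (hg : ContDiff ℝ 1 g)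
    (hmaps : ∀ x, ‖x‖ ≤ 1 → ‖g x‖ ≤ 1) : ∃ x, ‖x‖ ≤ 1 ∧ g x = x := by
  by_contra! hne
  let u : E → E := fun x => x - g x
  let q : E → ℝ := fun x => ⟪x, u x⟫
  let d : E → ℝ := fun x => q x ^ 2 + ‖u x‖ ^ 2 * (1 - ‖x‖ ^ 2)
  let c : E → ℝ := fun x => (√(d x) - q x) / ‖u x‖ ^ 2
  have hu : ∀ x, ‖x‖ ≤ 1 → 0 < ‖u x‖ ^ 2 := fun x hx => by
    have : u x ≠ 0 := sub_ne_zero.2 (hne x hx).symm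
    positivity
  have hq : ∀ x, ‖x‖ = 1 → 0 < q x := fun x hx => by
    have h1 := hu x hx.le
    have h2 : ‖u x‖ ^ 2 = ‖x‖ ^ 2 - 2 * ⟪x, g x⟫ + ‖g x‖ ^ 2 := norm_sub_sq_real x (g x)
    have h3 : q x = ‖x‖ ^ 2 - ⟪x, g x⟫ := by
      simp only [q, u, inner_sub_right, real_inner_self_eq_norm_sq]
    have h4 := hmaps x hx.le
    rw [hx] at h2 h3
    nlinarith [norm_nonneg (g x)]
  have hd : ∀ x, ‖x‖ ≤ 1 → 0 < d x := fun x hx => by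
    rcases hx.lt_or_eq with h | h
    · have h1 := hu x hx
      have h2 : 0 < 1 - ‖x‖ ^ 2 := by nlinarith [norm_nonneg x]
      positivity
    · have h1 := hq x h
      simp only [d, h, one_pow, sub_self, mul_zero, add_zero]
      positivity
  have hu_diff : ContDiff ℝ 1 u := contDiff_id.sub hg
  have hq_diff : ContDiff ℝ 1 q := contDiff_id.inner ℝ hu_diff
  have hd_diff : ContDiff ℝ 1 d :=
    (hq_diff.pow 2).add ((hu_diff.norm_sq ℝ).mul (contDiff_const.sub (contDiff_id.norm_sq ℝ)))
  have hc_diff : ContDiffOn ℝ 1 c (closedBall 0 1) :=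
    ((hd_diff.contDiffOn.sqrt fun x hx => (hd x (mem_closedBall_zero_iff.1 hx)).ne').sub
      hq_diff.contDiffOn).div (hu_diff.norm_sq ℝ).contDiffOn
      fun x hx => (hu x (mem_closedBall_zero_iff.1 hx)).ne'
  refine not_contDiffOn_retraction (r := fun x => x + c x • u x)
    (contDiffOn_id.add (hc_diff.smul hu_diff.contDiffOn)) (fun x hx => ?_) fun x hx => ?_
  · have h1 : d x = q x ^ 2 := by simp [d, hx]
    simp [c, h1, Real.sqrt_sq (hq x hx).le]
  · have h1 := hu x hx.le
    have h2 : c x * ‖u x‖ ^ 2 = √(d x) - q x := div_mul_cancel₀ _ h1.ne'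
    have h3 : √(d x) ^ 2 = q x ^ 2 + ‖u x‖ ^ 2 * (1 - ‖x‖ ^ 2) := Real.sq_sqrt (hd x hx.le).le
    have h4 : ‖x + c x • u x‖ ^ 2 = ‖x‖ ^ 2 + 2 * (c x * q x) + c x ^ 2 * ‖u x‖ ^ 2 := by
      rw [norm_add_sq_real, inner_smul_right, norm_smul, mul_pow, Real.norm_eq_abs, sq_abs]
    have h5 : ‖u x‖ ^ 2 * (‖x + c x • u x‖ ^ 2 - 1) = 0 := by
      have h6 : √(d x) = c x * ‖u x‖ ^ 2 + q x := by linarith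
      rw [h6] at h3
      rw [h4]
      linear_combination h3
    have h6 : ‖x + c x • u x‖ ^ 2 = 1 :=
      sub_eq_zero.1 ((mul_eq_zero.1 h5).resolve_left h1.ne')
    exact (pow_eq_one_iff_of_nonneg (norm_nonneg _) two_ne_zero).1 h6

/-- **Brouwer's fixed point theorem** for the closed unit ball. -/
theorem ContinuousOn.exists_fixedPoint_closedBall {f : E → E}
    (hf : ContinuousOn f (closedBall 0 1)) (hmaps : ∀ x, ‖x‖ ≤ 1 → ‖f x‖ ≤ 1) :
    ∃ x, ‖x‖ ≤ 1 ∧ f x = x := by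
  have hcomp := isCompact_closedBall (0 : E) 1
  obtain ⟨x₀, hx₀, hmin⟩ := hcomp.exists_isMinOn (nonempty_closedBall.2 zero_le_one)
    (hf.sub continuousOn_id).norm
  rw [mem_closedBall_zero_iff] at hx₀
  by_contra! hne
  obtain ⟨P, hPlip, hPmem, hPid, -⟩ := exists_lipschitz_proj
    (nonempty_closedBall.2 zero_le_one) hcomp (convex_closedBall 0 1)
  have hη : 0 < ‖f x₀ - x₀‖ := norm_pos_iff.2 (sub_ne_zero.2 (hne x₀ hx₀))
  set η := ‖f x₀ - x₀‖
  have huc : UniformContinuous fun x => f (P x) := by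
    rw [← uniformContinuousOn_univ]
    exact (hcomp.uniformContinuousOn_of_continuous hf).comp
      hPlip.uniformContinuous.uniformContinuousOn fun x _ => hPmem x
  obtain ⟨g, hg, hgf⟩ := huc.exists_contDiff_dist_le (half_pos hη)
  have hclose : ∀ x, ‖x‖ ≤ 1 → ‖g x - f x‖ < η / 2 := fun x hx => by
    have := hgf x
    rwa [hPid x (mem_closedBall_zero_iff.2 hx), dist_eq_norm] at this
  have hs : 0 < 1 + η / 2 := by positivity
  have hgn : ∀ x, ‖x‖ ≤ 1 → ‖g x‖ ≤ 1 + η / 2 := fun x hx => by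
    have h1 := norm_add_le (f x) (g x - f x)
    rw [add_sub_cancel] at h1
    linarith [hmaps x hx, hclose x hx]
  obtain ⟨x, hx, hfix⟩ := ContDiff.exists_fixedPoint_closedBall
    (g := fun x => (1 + η / 2)⁻¹ • g x) ((hg.of_le (by simp)).const_smul _) fun x hx => by
      rw [norm_smul, norm_inv, Real.norm_of_nonneg hs.le, inv_mul_le_iff₀ hs, mul_one]
      exact hgn x hx
  have hgx : g x = (1 + η / 2) • x := (inv_smul_eq_iff₀ hs.ne').1 hfix
  have h1 : ‖g x - x‖ ≤ η / 2 := by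
    rw [hgx, add_smul, one_smul, add_sub_cancel_left, norm_smul, Real.norm_of_nonneg (by positivity)]
    nlinarith
  have h2 : η ≤ ‖f x - x‖ := hmin (mem_closedBall_zero_iff.2 hx)
  have h3 := norm_sub_le_norm_sub_add_norm_sub (f x) (g x) x
  have h4 := hclose x hx
  rw [norm_sub_rev] at h4
  linarith

/-- **Brouwer's fixed point theorem** for compact convex sets. -/
theorem ContinuousOn.exists_fixedPoint_of_convex {X : Set E} (hne : X.Nonempty)
    (hcomp : IsCompact X) (hconv : Convex ℝ X) {f : E → E} (hf : ContinuousOn f X)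
    (hmaps : ∀ x ∈ X, f x ∈ X) : ∃ x ∈ X, f x = x := by
  obtain ⟨P, hPlip, hPmem, hPid, -⟩ := exists_lipschitz_proj hne hcomp hconv
  obtain ⟨R, hR, hXR⟩ := hcomp.isBounded.exists_pos_norm_le
  have hcont : Continuous fun x : E => R⁻¹ • f (P (R • x)) :=
    (hf.comp_continuous (hPlip.continuous.comp (continuous_const_smul R))
      fun x => hPmem _).const_smul _
  obtain ⟨x, -, hx⟩ := ContinuousOn.exists_fixedPoint_closedBall hcont.continuousOn fun x _ => by
    rw [norm_smul, norm_inv, Real.norm_of_nonneg hR.le, inv_mul_le_iff₀ hR, mul_one]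
    exact hXR _ (hmaps _ (hPmem _))
  have hRx : f (P (R • x)) = R • x := (inv_smul_eq_iff₀ hR.ne').1 hx
  have hmem : R • x ∈ X := hRx ▸ hmaps _ (hPmem _)
  exact ⟨R • x, hmem, by rwa [hPid _ hmem] at hRx⟩

end Brouwer

/-- First-order condition for a proximal step: minimizing `φ + ‖· - z‖² / (2ρ)` over a convex set
is the same as `(z - x) / ρ` being a subgradient of `φ` on that set. -/
theorem prox_minimizer_iff_subgradient {E : Type*} [NormedAddCommGroup E] [InnerProductSpace ℝ E]
    {X : Set E} {φ : E → ℝ} (hφ : ConvexOn ℝ X φ) {ρ : ℝ} (hρ : 0 < ρ) {x z : E} (hx : x ∈ X) :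
    (∀ y ∈ X, φ x + 1 / (2 * ρ) * ‖x - z‖ ^ 2 ≤ φ y + 1 / (2 * ρ) * ‖y - z‖ ^ 2) ↔
      ∀ y ∈ X, φ x + ⟪ρ⁻¹ • (z - x), y - x⟫ ≤ φ y := by
  have hexp : ∀ y (t : ℝ), 1 / (2 * ρ) * ‖x + t • (y - x) - z‖ ^ 2 =
      1 / (2 * ρ) * ‖x - z‖ ^ 2 - t * ⟪ρ⁻¹ • (z - x), y - x⟫ +
        t ^ 2 * (1 / (2 * ρ) * ‖y - x‖ ^ 2) := by
    intro y t
    rw [add_sub_right_comm, norm_add_sq_real, norm_smul, mul_pow, Real.norm_eq_abs, sq_abs,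
      inner_smul_right, real_inner_smul_left, ← neg_sub x z, inner_neg_left]
    field_simp
    ring
  constructor
  · intro h y hy
    have hstep : ∀ t : ℝ, 0 < t → t ≤ 1 →
        φ x + ⟪ρ⁻¹ • (z - x), y - x⟫ ≤ φ y + t * (1 / (2 * ρ) * ‖y - x‖ ^ 2) := by
      intro t ht ht1
      have hc := hφ.2 hx hy (sub_nonneg.2 ht1) ht.le (sub_add_cancel 1 t)
      have hpt : (1 - t) • x + t • y = x + t • (y - x) := by module
      have hm := h _ (hφ.1 hx hy (sub_nonneg.2 ht1) ht.le (sub_add_cancel 1 t))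
      rw [hpt] at hc hm
      rw [hexp] at hm
      simp only [smul_eq_mul] at hc
      refine le_of_mul_le_mul_left ?_ ht
      nlinarith
    have hlim : Tendsto (fun t : ℝ => φ y + t * (1 / (2 * ρ) * ‖y - x‖ ^ 2)) (𝓝[>] 0)
        (𝓝 (φ y)) := by
      have : Continuous fun t : ℝ => φ y + t * (1 / (2 * ρ) * ‖y - x‖ ^ 2) := by fun_prop
      simpa using (this.tendsto 0).mono_left nhdsWithin_le_nhds
    refine ge_of_tendsto hlim ?_
    filter_upwards [Ioc_mem_nhdsGT one_pos] with t ht using hstep t ht.1 ht.2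
  · intro h y hy
    have h1 := hexp y 1
    rw [one_smul, add_sub_cancel] at h1
    have h2 : 0 ≤ 1 / (2 * ρ) * ‖y - x‖ ^ 2 := by positivity
    linarith [h y hy]

/-- Under the closed-graph assumption on the (convex-analysis)
subdifferential of the surrogate in its first argument, the proximal MM map
x′ ↦ argmin_{x∈X} V̂(x;x′) + (1/(2ρ))‖x−x′‖² is continuous on X and has a fixed
point in X. -/
theorem stmt_10 {n : ℕ} (X : Set (EuclideanSpace ℝ (Fin n)))
    (hXne : X.Nonempty) (hXcomp : IsCompact X) (hXconv : Convex ℝ X)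
    (Vhat : EuclideanSpace ℝ (Fin n) → EuclideanSpace ℝ (Fin n) → ℝ)
    (hVconv : ∀ x' ∈ X, ConvexOn ℝ X (fun x => Vhat x x'))
    (hVcont : ∀ x' ∈ X, ContinuousOn (fun x => Vhat x x') X)
    (hclosed : IsClosed {p : EuclideanSpace ℝ (Fin n) × EuclideanSpace ℝ (Fin n) ×
        EuclideanSpace ℝ (Fin n) |
      p.2.1 ∈ X ∧ p.2.2 ∈ X ∧
        ∀ y ∈ X, Vhat p.2.1 p.2.2 + ⟪p.1, y - p.2.1⟫ ≤ Vhat y p.2.2})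
    (ρ : ℝ) (hρ : 0 < ρ)
    (M : EuclideanSpace ℝ (Fin n) → EuclideanSpace ℝ (Fin n))
    (hMmem : ∀ x' ∈ X, M x' ∈ X)
    (hMmin : ∀ x' ∈ X, ∀ x ∈ X,
      Vhat (M x') x' + 1 / (2 * ρ) * ‖M x' - x'‖ ^ 2 ≤
        Vhat x x' + 1 / (2 * ρ) * ‖x - x'‖ ^ 2)
    (hMuniq : ∀ x' ∈ X, ∀ x ∈ X,
      (∀ y ∈ X, Vhat x x' + 1 / (2 * ρ) * ‖x - x'‖ ^ 2 ≤
        Vhat y x' + 1 / (2 * ρ) * ‖y - x'‖ ^ 2) → x = M x') :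
    ContinuousOn M X ∧ ∃ x ∈ X, M x = x := by
  have hM : ContinuousOn M X := by
    intro z hz
    refine (tendsto_iff_ultrafilter _ _ _).2 fun F hF => ?_
    have hFX : ∀ᶠ w in (F : Filter _), w ∈ X := hF.trans inf_le_right (mem_principal_self X)
    have hFz : Tendsto id (F : Filter (EuclideanSpace ℝ (Fin n))) (𝓝 z) :=
      hF.trans nhdsWithin_le_nhds
    obtain ⟨x, hx, hFx⟩ := hXcomp.ultrafilter_le_nhds' (F.map M) (hFX.mono hMmem)
    have hFM : Tendsto M F (𝓝 x) := hFx
    have hlim : Tendsto (fun w => (ρ⁻¹ • (w - M w), M w, w)) F (𝓝 (ρ⁻¹ • (z - x), x, z)) :=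
      ((hFz.sub hFM).const_smul ρ⁻¹).prodMk_nhds (hFM.prodMk_nhds hFz)
    have hsub := hclosed.mem_of_tendsto hlim (hFX.mono fun w hw => ⟨hMmem w hw, hw,
      (prox_minimizer_iff_subgradient (hVconv w hw) hρ (hMmem w hw)).1 (hMmin w hw)⟩)
    rw [← hMuniq z hz x hx
      ((prox_minimizer_iff_subgradient (hVconv z hz) hρ hx).2 hsub.2.2)]
    exact hFM
  exact ⟨hM, hM.exists_fixedPoint_of_convex hXne hXcomp hXconv hMmem⟩
end

section
/- Let g : ℝⁿ → ℝ, and let h₁, …, h_K : ℝⁿ → ℝ be convex differentiable functions whose gradients are Lipschitz continuous with common constant κ₁ > 0. Define G(x) := g(x) − max_{1≤k≤K} h_k(x), and for x′ ∈ ℝⁿ and ε > 0 define the ε-active set A^ε(x′) := { k : h_k(x′) ≥ max_{1≤k′≤K} h_{k′}(x′) − ε } and the surrogate Ĝ^ε(x; x′) := g(x) − max_{k ∈ A^ε(x′)} [ h_k(x′) + ∇h_k(x′)ᵀ(x − x′) ]. Then: (i) Ĝ^ε(x; x′) ≥ G(x) for all x ∈ ℝⁿ; (ii) Ĝ^ε(x′;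 x′) = G(x′); and (iii) there exists δ > 0 (depending on x′ and ε) such that for all x with ‖x − x′‖ ≤ δ: Ĝ^ε(x; x′) ≤ G(x) + (κ₁/2)‖x − x′‖². -/
open scoped RealInnerProductSpace

section Gradient

variable {E : Type*} [NormedAddCommGroup E] [InnerProductSpace ℝ E] [CompleteSpace E]

theorem Differentiable.hasDerivAt_comp_add_smul_gradient {f : E → ℝ} (hf : Differentiable ℝ f)
    (x d : E) (t : ℝ) :
    HasDerivAt (fun s : ℝ => f (x + s • d)) ⟪gradient f (x + t • d), d⟫ t := by
  have hline : HasDerivAt (fun s : ℝ => x + s • d) d t := by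
    simpa using ((hasDerivAt_id t).smul_const d).const_add x
  have hcomp := (hf (x + t • d)).hasGradientAt.hasFDerivAt.comp_hasDerivAt t hline
  rwa [InnerProductSpace.toDual_apply_apply] at hcomp

/-- A convex differentiable function lies above its tangent planes. -/
theorem ConvexOn.add_inner_gradient_le {f : E → ℝ} (hc : ConvexOn ℝ Set.univ f)
    (hf : Differentiable ℝ f) (x y : E) :
    f x + ⟪gradient f x, y - x⟫ ≤ f y := by
  have hline : ConvexOn ℝ Set.univ (fun s : ℝ => f (x + s • (y - x))) := by
    refine ⟨convex_univ, fun s _ t _ a b ha hb hab => ?_⟩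
    have hpt : x + (a • s + b • t) • (y - x) =
        a • (x + s • (y - x)) + b • (x + t • (y - x)) := by
      obtain rfl : b = 1 - a := by linarith
      simp only [smul_eq_mul]
      module
    simpa only [hpt] using hc.2 (Set.mem_univ _) (Set.mem_univ _) ha hb hab
  have hslope := hline.le_slope_of_hasDerivAt (Set.mem_univ 0) (Set.mem_univ 1) one_pos
    (hf.hasDerivAt_comp_add_smul_gradient x (y - x) 0)
  simp only [slope_def_field, zero_smul, one_smul, add_zero, add_sub_cancel, sub_zero,
    div_one] at hslope
  linarith

/-- The descent lemma for functions with Lipschitz gradient. -/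
theorem LipschitzWith.le_add_inner_gradient_add_sq {f : E → ℝ} {κ : NNReal}
    (hL : LipschitzWith κ (gradient f)) (hf : Differentiable ℝ f) (x y : E) :
    f y ≤ f x + ⟪gradient f x, y - x⟫ + (κ : ℝ) / 2 * ‖y - x‖ ^ 2 := by
  set d := y - x with hd
  have hderiv (t : ℝ) : HasDerivAt
      (fun s : ℝ => f (x + s • d) - s * ⟪gradient f x, d⟫ - (κ : ℝ) / 2 * ‖d‖ ^ 2 * s ^ 2)
      (⟪gradient f (x + t • d), d⟫ - ⟪gradient f x, d⟫ - κ * ‖d‖ ^ 2 * t) t := by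
    refine HasDerivAt.congr_deriv (((hf.hasDerivAt_comp_add_smul_gradient x d t).sub
      ((hasDerivAt_id t).mul_const ⟪gradient f x, d⟫)).sub
      (((hasDerivAt_id t).pow 2).const_mul ((κ : ℝ) / 2 * ‖d‖ ^ 2))) ?_
    simp only [id, Nat.cast_ofNat, Nat.add_one_sub_one, pow_one]
    ring
  have hanti : AntitoneOn
      (fun s : ℝ => f (x + s • d) - s * ⟪gradient f x, d⟫ - (κ : ℝ) / 2 * ‖d‖ ^ 2 * s ^ 2)
      (Set.Icc 0 1) := by
    refine antitoneOn_of_deriv_nonpos (convex_Icc 0 1)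
      (fun t _ => (hderiv t).continuousAt.continuousWithinAt)
      (fun t _ => (hderiv t).differentiableAt.differentiableWithinAt) fun t ht => ?_
    rw [interior_Icc] at ht
    rw [(hderiv t).deriv, ← inner_sub_left]
    have hgrad : ‖gradient f (x + t • d) - gradient f x‖ ≤ κ * (t * ‖d‖) := by
      simpa [norm_smul, abs_of_pos ht.1] using hL.norm_sub_le (x + t • d) x
    have hinner := (real_inner_le_norm (gradient f (x + t • d) - gradient f x) d).trans
      (mul_le_mul_of_nonneg_right hgrad (norm_nonneg d))
    linarith
  have hle := hanti (Set.left_mem_Icc.2 zero_le_one) (Set.right_mem_Icc.2 zero_le_one) zero_le_one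
  simp only [one_smul, zero_smul, add_zero, hd, add_sub_cancel] at hle
  linarith

end Gradient

/-- Properties of the ε-active linearization surrogate of a
difference-of-convex function with a max-smooth concave part: majorization,
touching at the base point, and a local quadratic upper bound with the Lipschitz
constant of the gradients. -/
theorem stmt_12 {n K : ℕ} (hK : 0 < K)
    (g : EuclideanSpace ℝ (Fin n) → ℝ)
    (h : Fin K → EuclideanSpace ℝ (Fin n) → ℝ)
    (hconv : ∀ k, ConvexOn ℝ Set.univ (h k))
    (hdiff : ∀ k, Differentiable ℝ (h k))
    (κ₁ : NNReal) (hκ₁ : 0 < κ₁)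
    (hgradLip : ∀ k, LipschitzWith κ₁ (gradient (h k)))
    (G : EuclideanSpace ℝ (Fin n) → ℝ)
    (hGdef : ∀ x, G x = g x - sSup (Set.range fun k => h k x))
    (x' : EuclideanSpace ℝ (Fin n)) (ε : ℝ) (hε : 0 < ε)
    (Ghat : EuclideanSpace ℝ (Fin n) → ℝ)
    (hGhatdef : ∀ x, Ghat x = g x -
      sSup ((fun k => h k x' + ⟪gradient (h k) x', x - x'⟫) ''
        {k | ∀ k', h k' x' - ε ≤ h k x'})) :
    (∀ x, G x ≤ Ghat x) ∧
    Ghat x' = G x' ∧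
    ∃ δ > 0, ∀ x : EuclideanSpace ℝ (Fin n), ‖x - x'‖ ≤ δ →
      Ghat x ≤ G x + (κ₁ : ℝ) / 2 * ‖x - x'‖ ^ 2 := by
  have : Nonempty (Fin K) := ⟨⟨0, hK⟩⟩
  set A : Set (Fin K) := {k | ∀ k', h k' x' - ε ≤ h k x'} with hA
  have hbdd (x) : BddAbove (Set.range fun k => h k x) := (Set.finite_range _).bddAbove
  have hbddA (x) : BddAbove ((fun k => h k x' + ⟪gradient (h k) x', x - x'⟫) '' A) :=
    (A.toFinite.image _).bddAbove
  obtain ⟨k₀, hk₀⟩ := Finite.exists_max fun k => h k x'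
  have hk₀A : k₀ ∈ A := fun k => by linarith [hk₀ k]
  have hmajor (x) : G x ≤ Ghat x := by
    rw [hGdef, hGhatdef]
    refine sub_le_sub_left (csSup_le (Set.Nonempty.image _ ⟨k₀, hk₀A⟩) ?_) _
    rintro _ ⟨k, -, rfl⟩
    exact ((hconv k).add_inner_gradient_le (hdiff k) x' x).trans (le_csSup (hbdd x) ⟨k, rfl⟩)
  refine ⟨hmajor, le_antisymm ?_ (hmajor x'), ?_⟩
  · rw [hGdef, hGhatdef]
    refine sub_le_sub_left (csSup_le (Set.range_nonempty _) ?_) _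
    rintro _ ⟨k, rfl⟩
    exact (hk₀ k).trans (le_csSup (hbddA x') (a := h k₀ x') ⟨k₀, hk₀A, by simp⟩)
  · have hnear : ∀ᶠ x in nhds x', ∀ k, k ∉ A → ∃ k', h k x < h k' x := by
      refine Filter.eventually_all.2 fun k => ?_
      by_cases hk : k ∈ A
      · exact Filter.Eventually.of_forall fun _ hk' => absurd hk hk'
      · obtain ⟨k', hk'⟩ : ∃ k', h k x' < h k' x' - ε := by
          simpa only [hA, Set.mem_ofPred_eq, not_forall, not_le] using hk
        filter_upwards [(hdiff k).continuous.continuousAt.eventually_lt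
          (hdiff k').continuous.continuousAt (show h k x' < h k' x' by linarith)] with x hx _
        exact ⟨k', hx⟩
    obtain ⟨δ, hδ, hball⟩ := Metric.nhds_basis_closedBall.eventually_iff.1 hnear
    refine ⟨δ, hδ, fun x hx => ?_⟩
    obtain ⟨k, hk⟩ := Finite.exists_max fun k => h k x
    have hkA : k ∈ A := by
      by_contra hkA
      obtain ⟨k', hk'⟩ := hball (mem_closedBall_iff_norm.2 hx) k hkA
      exact hk'.not_ge (hk k')
    have hsup : sSup (Set.range fun k => h k x) ≤ h k x :=
      csSup_le (Set.range_nonempty _) (Set.forall_mem_range.2 hk)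
    have hlin := le_csSup (hbddA x) (Set.mem_image_of_mem _ hkA)
    have hdesc := (hgradLip k).le_add_inner_gradient_add_sq (hdiff k) x' x
    rw [hGdef, hGhatdef]
    linarith
end

section
/- Let u : ℝ → ℝ be a concave nondecreasing function with u(0) = 0 and u(t) ≤ t for all t ∈ ℝ (i.e., 1 is a supergradient of u at 0). Let Z be a bounded random variable whose support is contained in the interval [z_min, z_max]. If the supremum S_u(Z) := sup_{η ∈ ℝ} { η + E[u(Z − η)] } is attained at some η* ∈ ℝ, then it is attained at some point of [z_min, z_max]; that is, S_u(Z) = sup_{η ∈ [z_min, z_max]} { η + E[u(Z − η)] }. -/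
open MeasureTheory

/-- A concave function with `u 0 = 0` and `u t ≤ t` has increments, moving away from the origin,
that are bounded by those of the identity. -/
theorem ConcaveOn.le_add_sub_of_mem_uIcc {u : ℝ → ℝ} (huconc : ConcaveOn ℝ Set.univ u)
    (hu0 : u 0 = 0) (hu1 : ∀ t : ℝ, u t ≤ t) {a b : ℝ} (ha : a ∈ Set.uIcc 0 b) :
    u b ≤ u a + (b - a) := by
  rw [← segment_eq_uIcc] at ha
  obtain ⟨x, y, hx, hy, hxy, rfl⟩ := ha
  have h := huconc.2 (Set.mem_univ 0) (Set.mem_univ b) hx hy hxy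
  simp only [hu0, smul_eq_mul, mul_zero, zero_add] at h ⊢
  obtain rfl : x = 1 - y := by linarith
  linarith [mul_le_mul_of_nonneg_left (hu1 b) hx]

/-- A monotone function of an almost surely bounded random variable is integrable. -/
theorem Monotone.integrable_comp_of_ae_mem_Icc {Ω : Type*} [MeasurableSpace Ω] {μ : Measure Ω}
    [IsFiniteMeasure μ] {u : ℝ → ℝ} (humono : Monotone u) {X : Ω → ℝ} (hX : Measurable X)
    {a b : ℝ} (h : ∀ᵐ ω ∂μ, X ω ∈ Set.Icc a b) : Integrable (fun ω => u (X ω)) μ :=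
  Integrable.of_mem_Icc (u a) (u b) (humono.measurable.comp hX).aemeasurable
    (h.mono fun _ hω => ⟨humono hω.1, humono hω.2⟩)

/-- If the supremum defining the Optimized Certainty Equivalent
S_u(Z) = sup_η { η + E[u(Z − η)] } of a bounded random variable Z with support in
[z_min, z_max] is attained, then it is attained at some point of [z_min, z_max];
in particular the supremum over ℝ equals the supremum over [z_min, z_max]. -/
theorem stmt_13 {Ω : Type*} [MeasurableSpace Ω] (μ : Measure Ω)
    [IsProbabilityMeasure μ]
    (u : ℝ → ℝ) (huconc : ConcaveOn ℝ Set.univ u) (humono : Monotone u)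
    (hu0 : u 0 = 0) (hu1 : ∀ t : ℝ, u t ≤ t)
    (Z : Ω → ℝ) (hZmeas : Measurable Z)
    (zmin zmax : ℝ) (hsupp : ∀ᵐ ω ∂μ, Z ω ∈ Set.Icc zmin zmax)
    (hatt : ∃ ηstar : ℝ, ∀ η : ℝ,
      η + ∫ ω, u (Z ω - η) ∂μ ≤ ηstar + ∫ ω, u (Z ω - ηstar) ∂μ) :
    (∃ η0 ∈ Set.Icc zmin zmax, ∀ η : ℝ,
      η + ∫ ω, u (Z ω - η) ∂μ ≤ η0 + ∫ ω, u (Z ω - η0) ∂μ) ∧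
    sSup (Set.range fun η : ℝ => η + ∫ ω, u (Z ω - η) ∂μ) =
      sSup ((fun η : ℝ => η + ∫ ω, u (Z ω - η) ∂μ) '' Set.Icc zmin zmax) := by
  have hint (η : ℝ) : Integrable (fun ω => u (Z ω - η)) μ :=
    humono.integrable_comp_of_ae_mem_Icc (hZmeas.sub_const η)
      (hsupp.mono fun _ hω => ⟨sub_le_sub_right hω.1 η, sub_le_sub_right hω.2 η⟩)
  have hle : zmin ≤ zmax := by
    obtain ⟨ω, hω⟩ := hsupp.exists
    exact hω.1.trans hω.2
  have hcompare {η η' : ℝ} (h : ∀ᵐ ω ∂μ, Z ω - η' ∈ Set.uIcc 0 (Z ω - η)) :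
      η + ∫ ω, u (Z ω - η) ∂μ ≤ η' + ∫ ω, u (Z ω - η') ∂μ := by
    have := integral_mono_ae (hint η) ((hint η').add (integrable_const (η' - η)))
      (h.mono fun ω hω => by
        have := huconc.le_add_sub_of_mem_uIcc hu0 hu1 hω
        simp only [Pi.add_apply]
        linarith)
    simp only [Pi.add_apply] at this
    rw [integral_add (hint η') (integrable_const _)] at this
    simp only [integral_const, probReal_univ, one_smul] at this
    linarith
  have hproj (η : ℝ) : ∃ η0 ∈ Set.Icc zmin zmax,
      η + ∫ ω, u (Z ω - η) ∂μ ≤ η0 + ∫ ω, u (Z ω - η0) ∂μ := by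
    rcases lt_or_ge η zmin with h1 | h1
    · refine ⟨zmin, Set.left_mem_Icc.2 hle, hcompare (hsupp.mono fun ω hω => ?_)⟩
      exact Set.mem_uIcc.2 (Or.inl ⟨by linarith [hω.1], by linarith⟩)
    rcases lt_or_ge zmax η with h2 | h2
    · refine ⟨zmax, Set.right_mem_Icc.2 hle, hcompare (hsupp.mono fun ω hω => ?_)⟩
      exact Set.mem_uIcc.2 (Or.inr ⟨by linarith, by linarith [hω.2]⟩)
    exact ⟨η, ⟨h1, h2⟩, le_rfl⟩
  obtain ⟨ηstar, hstar⟩ := hatt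
  obtain ⟨η0, hη0, hle0⟩ := hproj ηstar
  have hmax (η : ℝ) := (hstar η).trans hle0
  refine ⟨⟨η0, hη0, hmax⟩, ?_⟩
  have hgreatest : IsGreatest (Set.range fun η : ℝ => η + ∫ ω, u (Z ω - η) ∂μ)
      (η0 + ∫ ω, u (Z ω - η0) ∂μ) :=
    ⟨⟨η0, rfl⟩, Set.forall_mem_range.2 hmax⟩
  have hgreatest' : IsGreatest ((fun η : ℝ => η + ∫ ω, u (Z ω - η) ∂μ) '' Set.Icc zmin zmax)
      (η0 + ∫ ω, u (Z ω - η0) ∂μ) :=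
    ⟨⟨η0, hη0, rfl⟩, Set.forall_mem_image.2 fun η _ => hmax η⟩
  rw [hgreatest.csSup_eq, hgreatest'.csSup_eq]
end
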